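/- arXiv:1609.04125 — 2 statements merged into one kernel-verified Lean document; each statement's English description precedes it below -/
import Mathlib

section
/- Let a > 2 and set b = √(a² − 4). For j ∈ ℕ define φ_j(x) = (b/π)^{1/4} · 2^{−j/2} (j!)^{−1/2} · e^{−b x²/2} · H_j(√b · x), where H_j is the jth physicists' Hermite polynomial. Then for every j ∈ ℕ and every x ∈ ℝ, ∫_ℝ (1/√π) exp(−(a/2)x² + 2xy − (a/2)y²) φ_j(y) dy = ((a+b)/2)^{−j−1/2} φ_j(x). -/
open Filter Topology

/-- The j-th physicists' Hermite polynomial, H_j(x) = (−1)^j e^{x²} (d^j/dx^j) e^{−x²}. -/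
noncomputable def physHermite (j : ℕ) (x : ℝ) : ℝ :=
  (-1) ^ j * Real.exp (x ^ 2) * iteratedDeriv j (fun y => Real.exp (-y ^ 2)) x

/-- The normalized eigenfunctions φ_j(x) = (b/π)^{1/4} 2^{−j/2} (j!)^{−1/2}
e^{−bx²/2} H_j(√b x). -/
noncomputable def phiFn (b : ℝ) (j : ℕ) (x : ℝ) : ℝ :=
  (b / Real.pi) ^ ((1:ℝ)/4) * (2:ℝ) ^ (-(j : ℝ)/2) * ((Nat.factorial j : ℝ)) ^ (-(1:ℝ)/2) *
    Real.exp (-b * x ^ 2 / 2) * physHermite j (Real.sqrt b * x)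

open Polynomial MeasureTheory

/-- The physicists' Hermite polynomials, as polynomials with real coefficients. -/
noncomputable def physHermitePoly : ℕ → ℝ[X]
  | 0 => 1
  | n + 1 => 2 * X * physHermitePoly n - derivative (physHermitePoly n)

theorem derivative_physHermitePoly (n : ℕ) :
    derivative (physHermitePoly n) = 2 * (n : ℝ[X]) * physHermitePoly (n - 1) := by
  induction n with
  | zero => simp [physHermitePoly]
  | succ n ih =>
    cases n with
    | zero => simp [physHermitePoly]
    | succ m =>
      have h : derivative (derivative (physHermitePoly (m + 1)))
          = 2 * ((m + 1 : ℕ) : ℝ[X]) * derivative (physHermitePoly m) := by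
        rw [ih]; simp [derivative_mul]
      rw [physHermitePoly, derivative_sub, h, derivative_mul, ih]
      simp only [derivative_mul, derivative_ofNat, derivative_X, Nat.add_sub_cancel]
      rw [physHermitePoly]
      push_cast
      ring

theorem physHermitePoly_succ (n : ℕ) :
    physHermitePoly (n + 1)
      = 2 * X * physHermitePoly n - 2 * (n : ℝ[X]) * physHermitePoly (n - 1) := by
  rw [physHermitePoly, derivative_physHermitePoly]

theorem iteratedDeriv_exp_neg_sq (n : ℕ) :
    iteratedDeriv n (fun y : ℝ => Real.exp (-y ^ 2))
      = fun y => (-1) ^ n * (physHermitePoly n).eval y * Real.exp (-y ^ 2) := by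
  induction n with
  | zero => simp [physHermitePoly]
  | succ n ih =>
    rw [iteratedDeriv_succ, ih]
    funext y
    have h := (((physHermitePoly n).hasDerivAt y).const_mul ((-1 : ℝ) ^ n)).mul
      ((hasDerivAt_pow 2 y).fun_neg.exp)
    refine h.deriv.trans ?_
    simp only [physHermitePoly, eval_sub, eval_mul, eval_ofNat, eval_X]
    push_cast
    ring

theorem physHermite_eq_eval (n : ℕ) (x : ℝ) :
    physHermite n x = (physHermitePoly n).eval x := by
  rw [physHermite, iteratedDeriv_exp_neg_sq]
  have h1 : Real.exp (x ^ 2) * Real.exp (-x ^ 2) = 1 := by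
    rw [← Real.exp_add]; simp
  have h2 : ((-1 : ℝ) ^ n) * (-1) ^ n = 1 := by
    rw [← mul_pow]; simp
  linear_combination (physHermitePoly n).eval x * (-1) ^ n * (-1) ^ n * h1
    + (physHermitePoly n).eval x * h2

theorem integrable_exp_neg_mul_sq_mul_eval {c : ℝ} (hc : 0 < c) (p : ℝ[X]) :
    Integrable fun y : ℝ => Real.exp (-c * y ^ 2) * p.eval y := by
  induction p using Polynomial.induction_on' with
  | add p q hp hq =>
    refine (hp.add hq).congr (.of_forall fun y => ?_)
    simp [mul_add]
  | monomial n r =>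
    have h := (integrable_rpow_mul_exp_neg_mul_sq hc (s := n)
      (by have : (0 : ℝ) ≤ n := n.cast_nonneg
          linarith)).const_mul r
    refine h.congr (.of_forall fun y => ?_)
    simp only [Real.rpow_natCast, eval_monomial]
    ring

theorem exp_quadratic_eq {c : ℝ} (hc : c ≠ 0) (x y : ℝ) :
    Real.exp (2 * x * y - c * y ^ 2)
      = Real.exp (x ^ 2 / c) * Real.exp (-c * (y - x / c) ^ 2) := by
  rw [← Real.exp_add]
  congr 1
  field_simp
  ring

theorem integrable_exp_quadratic_mul_eval {c : ℝ} (hc : 0 < c) (x : ℝ) (p : ℝ[X]) :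
    Integrable fun y : ℝ => Real.exp (2 * x * y - c * y ^ 2) * p.eval y := by
  have h := ((integrable_exp_neg_mul_sq_mul_eval hc (p.comp (X + C (x / c)))).comp_sub_right
    (x / c)).const_mul (Real.exp (x ^ 2 / c))
  refine h.congr (.of_forall fun y => ?_)
  beta_reduce
  rw [exp_quadratic_eq hc.ne']
  simp [mul_assoc]

theorem integral_exp_quadratic {c : ℝ} (hc : 0 < c) (x : ℝ) :
    ∫ y : ℝ, Real.exp (2 * x * y - c * y ^ 2) = Real.exp (x ^ 2 / c) * √(Real.pi / c) := by
  simp_rw [exp_quadratic_eq hc.ne', integral_const_mul]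
  rw [integral_sub_right_eq_self (fun y : ℝ => Real.exp (-c * y ^ 2)), integral_gaussian]

/-- Integration by parts against the Gaussian weight. -/
theorem integral_exp_quadratic_mul_eval_parts {c : ℝ} (hc : 0 < c) (x : ℝ) (p : ℝ[X]) :
    ∫ y : ℝ, Real.exp (2 * x * y - c * y ^ 2) *
      ((C (2 * x) - C (2 * c) * X) * p + derivative p).eval y = 0 := by
  refine integral_eq_zero_of_hasDerivAt_of_integrable (fun y => ?_)
    (integrable_exp_quadratic_mul_eval hc x _) (integrable_exp_quadratic_mul_eval hc x p)
  have h := (((hasDerivAt_id y).const_mul (2 * x)).sub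
    ((hasDerivAt_pow 2 y).const_mul c)).exp.mul (p.hasDerivAt y)
  refine h.congr_deriv ?_
  simp
  ring

theorem integral_exp_quadratic_mul_physHermitePoly_succ {b c : ℝ} (hc : 0 < c) (hb : 0 ≤ b)
    (x : ℝ) (n : ℕ) :
    c * ∫ y : ℝ, Real.exp (2 * x * y - c * y ^ 2) * (physHermitePoly (n + 1)).eval (√b * y)
      = 2 * x * √b *
          (∫ y : ℝ, Real.exp (2 * x * y - c * y ^ 2) * (physHermitePoly n).eval (√b * y))
        - 2 * n * (c - b) *
          ∫ y : ℝ, Real.exp (2 * x * y - c * y ^ 2) *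
            (physHermitePoly (n - 1)).eval (√b * y) := by
  have hi (m : ℕ) : Integrable fun y : ℝ =>
      Real.exp (2 * x * y - c * y ^ 2) * (physHermitePoly m).eval (√b * y) := by
    refine (integrable_exp_quadratic_mul_eval hc x
      ((physHermitePoly m).comp (C √b * X))).congr (.of_forall fun y => ?_)
    simp
  have hs : √b * √b = b := Real.mul_self_sqrt hb
  have key := congrArg (√b * ·)
    (integral_exp_quadratic_mul_eval_parts hc x ((physHermitePoly n).comp (C √b * X)))
  simp only [← integral_const_mul, mul_zero] at key
  have hsub : Integrable fun y : ℝ =>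
      2 * x * √b * (Real.exp (2 * x * y - c * y ^ 2) * (physHermitePoly n).eval (√b * y))
      - 2 * n * (c - b) *
        (Real.exp (2 * x * y - c * y ^ 2) * (physHermitePoly (n - 1)).eval (√b * y)) :=
    ((hi n).const_mul _).sub ((hi (n - 1)).const_mul _)
  rw [eq_comm, ← sub_eq_zero, ← integral_const_mul, ← integral_const_mul, ← integral_const_mul,
    ← integral_sub ((hi n).const_mul _) ((hi (n - 1)).const_mul _),
    ← integral_sub hsub ((hi (n + 1)).const_mul _)]
  refine Eq.trans (integral_congr_ae (.of_forall fun y => ?_)) key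
  simp only [derivative_comp, derivative_physHermitePoly, physHermitePoly_succ, derivative_mul,
    derivative_C, derivative_X, eval_add, eval_sub, eval_mul, eval_comp, eval_C, eval_X,
    eval_ofNat, eval_natCast, eval_zero, eval_one]
  linear_combination (-2 * n * Real.exp (2 * x * y - c * y ^ 2)
    * (physHermitePoly (n - 1)).eval (√b * y)) * hs

theorem integral_exp_quadratic_mul_physHermitePoly {b c : ℝ} (hc : 0 < c) (hb : 0 ≤ b)
    (hbc : c * (c - b) = 1) (x : ℝ) (n : ℕ) :
    ∫ y : ℝ, Real.exp (2 * x * y - c * y ^ 2) * (physHermitePoly n).eval (√b * y)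
      = Real.exp (x ^ 2 / c) * √(Real.pi / c) * (c⁻¹ ^ n * (physHermitePoly n).eval (√b * x)) := by
  have hcb : c - b = c⁻¹ := eq_inv_of_mul_eq_one_right hbc
  induction n using Nat.strong_induction_on with
  | _ n ih =>
  cases n with
  | zero => simp [physHermitePoly, integral_exp_quadratic hc]
  | succ n =>
    apply mul_left_cancel₀ hc.ne'
    rw [integral_exp_quadratic_mul_physHermitePoly_succ hc hb, ih n (by omega),
      ih (n - 1) (by omega), physHermitePoly_succ, hcb]
    simp only [eval_sub, eval_mul, eval_ofNat, eval_X, eval_natCast]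
    cases n with
    | zero =>
      simp
      field_simp
    | succ m =>
      simp only [Nat.add_sub_cancel, pow_succ]
      field_simp

/-- The functions φ_j are eigenfunctions of the Gaussian kernel
(1/√π)exp(−(a/2)x² + 2xy − (a/2)y²) with eigenvalues ((a+b)/2)^{−j−1/2}. -/
theorem hermite_eigenfunctions (a b : ℝ) (ha : 2 < a) (hb : b = Real.sqrt (a ^ 2 - 4))
    (j : ℕ) (x : ℝ) :
    (∫ y : ℝ, (1 / Real.sqrt Real.pi) *
        Real.exp (-(a/2) * x ^ 2 + 2 * x * y - (a/2) * y ^ 2) * phiFn b j y)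
      = ((a + b) / 2) ^ (-(j : ℝ) - 1/2) * phiFn b j x := by
  have hb2 : b ^ 2 = a ^ 2 - 4 := by rw [hb, Real.sq_sqrt (by nlinarith)]
  have hb0 : 0 ≤ b := hb ▸ Real.sqrt_nonneg _
  set c := (a + b) / 2 with hc_def
  have hc : 0 < c := by linarith
  have hbc : c * (c - b) = 1 := by
    rw [hc_def]
    linear_combination -hb2 / 4
  set N := (b / Real.pi) ^ ((1:ℝ)/4) * (2:ℝ) ^ (-(j : ℝ)/2) *
    ((Nat.factorial j : ℝ)) ^ (-(1:ℝ)/2) with hN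
  have hint (y : ℝ) : (1 / √Real.pi) *
      Real.exp (-(a/2) * x ^ 2 + 2 * x * y - (a/2) * y ^ 2) * phiFn b j y
      = (1 / √Real.pi * Real.exp (-(a/2) * x ^ 2) * N) *
        (Real.exp (2 * x * y - c * y ^ 2) * (physHermitePoly j).eval (√b * y)) := by
    have he : Real.exp (-(a/2) * x ^ 2 + 2 * x * y - (a/2) * y ^ 2) * Real.exp (-b * y ^ 2 / 2)
        = Real.exp (-(a/2) * x ^ 2) * Real.exp (2 * x * y - c * y ^ 2) := by
      rw [← Real.exp_add, ← Real.exp_add, hc_def]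
      ring_nf
    rw [phiFn, ← hN, physHermite_eq_eval]
    linear_combination (1 / √Real.pi * N * (physHermitePoly j).eval (√b * y)) * he
  have he : Real.exp (-(a/2) * x ^ 2) * Real.exp (x ^ 2 / c) = Real.exp (-b * x ^ 2 / 2) := by
    rw [← Real.exp_add, div_eq_mul_inv (x ^ 2), ← eq_inv_of_mul_eq_one_right hbc, hc_def]
    ring_nf
  have hpow : c ^ (-(j : ℝ) - 1/2) = c⁻¹ ^ j * (1 / √c) := by
    rw [Real.rpow_sub hc, Real.rpow_neg hc.le, Real.rpow_natCast, ← Real.sqrt_eq_rpow, inv_pow]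
    ring
  have hpi : 1 / √Real.pi * √(Real.pi / c) = 1 / √c := by
    rw [Real.sqrt_div Real.pi_pos.le]
    have := (Real.sqrt_pos.2 Real.pi_pos).ne'
    field_simp
  simp_rw [hint]
  rw [integral_const_mul, integral_exp_quadratic_mul_physHermitePoly hc hb0 hbc, phiFn, ← hN,
    physHermite_eq_eval, hpow, ← hpi, ← he]
  ring
end

section
/- Let f : ℝ → ℝ be continuous, let ε ∈ ℝ, and let φ : ℝ → ℝ be continuous. For each n let λ_1^{(n)}, …, λ_n^{(n)} denote the eigenvalues (with multiplicity) of the real symmetric matrix T_n(f;ε). Then lim_{n→∞} (1/n) ∑_{j=1}^n φ(λ_j^{(n)}) = (1/2π) ∫₀¹ ∫₀^{2π} φ(f(x) − 2cos t) dt dx; in particular this limit is independent of ε. -/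
open Filter Topology

/-- The n×n shifted discrete Schrödinger matrix T_n(f;ε) with diagonal entries
f((j−1+ε)/n) for j = 1,…,n and −1 on the first super- and subdiagonals. -/
noncomputable def TmatShift (f : ℝ → ℝ) (ε : ℝ) (n : ℕ) : Matrix (Fin n) (Fin n) ℝ :=
  Matrix.of fun i j =>
    if (i : ℕ) = (j : ℕ) then f (((i : ℕ) + ε : ℝ) / (n : ℝ))
    else if (i : ℕ) + 1 = (j : ℕ) ∨ (j : ℕ) + 1 = (i : ℕ) then -1 else 0

open Finset Matrix

/-- The `n × n` Jacobi matrix with diagonal entries `d i` and off-diagonal entries `-1`. -/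
noncomputable def jacobiMatrix (d : ℤ → ℝ) (n : ℕ) : Matrix (Fin n) (Fin n) ℝ :=
  Matrix.of fun i j =>
    (if (i : ℕ) = (j : ℕ) then d (i : ℕ) else 0) -
      (if (j : ℕ) = (i : ℕ) + 1 then 1 else 0) - (if (i : ℕ) = (j : ℕ) + 1 then 1 else 0)

lemma jacobiMatrix_mulVec (d F : ℤ → ℝ) (n : ℕ) (i : Fin n) :
    (jacobiMatrix d n *ᵥ fun j => F (j : ℕ)) i =
      d (i : ℕ) * F (i : ℕ) - (if (i : ℕ) + 1 < n then F ((i : ℕ) + 1) else 0) -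
        (if 1 ≤ (i : ℕ) then F ((i : ℕ) - 1) else 0) := by
  obtain ⟨i, hi⟩ := i
  simp only [mulVec, dotProduct, jacobiMatrix, Matrix.of_apply]
  rw [Fin.sum_univ_eq_sum_range (fun j : ℕ => ((if i = j then d (i : ℕ) else 0) -
      (if j = i + 1 then 1 else 0) - (if i = j + 1 then 1 else 0)) * F (j : ℕ)) n]
  simp only [sub_mul, sum_sub_distrib, ite_mul, one_mul, zero_mul]
  congr 1
  · congr 1
    · simp [hi]
    · simp
  · rcases i with _ | i
    · simp
    · have : i < n := by omega
      simp [this]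

lemma sum_fin_ite_le_one {n : ℕ} (p : Fin n → Prop) [DecidablePred p]
    (hp : ∀ i j, p i → p j → i = j) : ∑ i, (if p i then (1 : ℝ) else 0) ≤ 1 := by
  rw [sum_boole]
  exact_mod_cast card_le_one.2 fun a ha b hb => hp a b (by simpa using ha) (by simpa using hb)

lemma sum_abs_jacobiMatrix_mulVec_le {d : ℤ → ℝ} {n : ℕ} {M : ℝ}
    (hd : ∀ i : ℕ, i < n → |d i| ≤ M) (v : Fin n → ℝ) :
    ∑ i, |(jacobiMatrix d n *ᵥ v) i| ≤ (M + 2) * ∑ i, |v i| := by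
  have col (j : Fin n) : ∑ i, |jacobiMatrix d n i j| ≤ M + 2 := by
    have hM : 0 ≤ M := (abs_nonneg _).trans (hd j j.2)
    calc ∑ i, |jacobiMatrix d n i j|
        ≤ ∑ i : Fin n, (M * (if (i : ℕ) = (j : ℕ) then 1 else 0) +
            (if (j : ℕ) = (i : ℕ) + 1 then 1 else 0) +
            (if (i : ℕ) = (j : ℕ) + 1 then 1 else 0)) := by
          refine sum_le_sum fun i _ => ?_
          have := hd i i.2
          simp only [jacobiMatrix, Matrix.of_apply]
          split_ifs <;> first | omega | simp [this]
      _ ≤ M * 1 + 1 + 1 := by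
          rw [sum_add_distrib, sum_add_distrib, ← mul_sum]
          gcongr <;> exact sum_fin_ite_le_one _ fun a b ha hb => Fin.ext (by omega)
      _ = M + 2 := by ring
  calc ∑ i, |(jacobiMatrix d n *ᵥ v) i|
      ≤ ∑ i, ∑ j, |jacobiMatrix d n i j| * |v j| := by
        refine sum_le_sum fun i _ => ?_
        simp only [← abs_mul, mulVec, dotProduct]
        exact abs_sum_le_sum_abs _ _
    _ = ∑ j, (∑ i, |jacobiMatrix d n i j|) * |v j| := by
        rw [sum_comm]; simp only [sum_mul]
    _ ≤ ∑ j, (M + 2) * |v j| := by gcongr with j; exact col j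
    _ = _ := by rw [mul_sum]

/-- One application of a Jacobi matrix to an approximate plane wave: `(d - c) ^ k * u` is mapped
to `(d - c) ^ (k + 1) * u` up to an error that is small in `ℓ¹`. -/
lemma sum_abs_jacobiMatrix_mulVec_wave_sub_le {d u : ℤ → ℝ} {n : ℕ} {M δ c : ℝ} (k : ℕ)
    (hM : 0 ≤ M) (hδ : 0 ≤ δ) (hd : ∀ i : ℕ, i < n → |d i| ≤ M)
    (hdδ : ∀ i : ℕ, i + 1 < n → |d (i + 1) - d i| ≤ δ) (hc : |c| ≤ 2)
    (hu : ∀ i, |u i| ≤ 1) (huc : ∀ i, u (i - 1) + u (i + 1) = c * u i) :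
    ∑ i : Fin n, |(jacobiMatrix d n *ᵥ fun j => (d (j : ℕ) - c) ^ k * u (j : ℕ)) i -
        (d (i : ℕ) - c) ^ (k + 1) * u (i : ℕ)| ≤
      2 * (k * (M + 2) ^ (k - 1) + (M + 2) ^ k) * (n * δ + 1) := by
  set R := M + 2
  have hR : 0 ≤ R := by positivity
  have ha (i : ℕ) (hi : i < n) : |d i - c| ≤ R := (abs_sub _ _).trans (add_le_add (hd i hi) hc)
  have hk (i : ℕ) (hi : i < n) : |(d i - c) ^ k| ≤ R ^ k := by
    rw [abs_pow]; exact pow_le_pow_left₀ (abs_nonneg _) (ha i hi) k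
  have hstep (i : ℕ) (hi : i + 1 < n) :
      |(d (i + 1) - c) ^ k - (d i - c) ^ k| ≤ δ * k * R ^ (k - 1) := by
    refine (abs_pow_sub_pow_le _ _ _).trans ?_
    have h1 : |d (i + 1) - c| ≤ R := by simpa using ha (i + 1) hi
    have h2 := ha i (by omega)
    have h3 := hdδ i hi
    gcongr
    · simpa using h3
    · exact max_le h1 h2
  set A := δ * k * R ^ (k - 1) with hA_def
  have hA : 0 ≤ A := by positivity
  have hpt (i : Fin n) : |(jacobiMatrix d n *ᵥ fun j => (d (j : ℕ) - c) ^ k * u (j : ℕ)) i -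
        (d (i : ℕ) - c) ^ (k + 1) * u (i : ℕ)| ≤
      2 * A + R ^ k * (if (i : ℕ) + 1 = n then 1 else 0) +
        R ^ k * (if (i : ℕ) = 0 then 1 else 0) := by
    rw [jacobiMatrix_mulVec d (fun i => (d i - c) ^ k * u i)]
    obtain ⟨i, hi⟩ := i
    simp only
    have e1 : |(d i - c) ^ k * u (i + 1) -
        (if i + 1 < n then (d (i + 1) - c) ^ k * u (i + 1) else 0)| ≤
        A + R ^ k * (if i + 1 = n then 1 else 0) := by
      split_ifs with h1 h2 h2
      · omega
      · rw [← sub_mul, abs_mul, abs_sub_comm, mul_zero, add_zero]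
        exact (mul_le_of_le_one_right (abs_nonneg _) (hu _)).trans (hstep i h1)
      · rw [sub_zero, abs_mul, mul_one]
        exact (mul_le_of_le_one_right (abs_nonneg _) (hu _)).trans
          ((hk i hi).trans (le_add_of_nonneg_left hA))
      · omega
    have e2 : |(d i - c) ^ k * u (i - 1) -
        (if 1 ≤ i then (d (i - 1) - c) ^ k * u (i - 1) else 0)| ≤
        A + R ^ k * (if i = 0 then 1 else 0) := by
      split_ifs with h1 h2 h2
      · omega
      · rw [← sub_mul, abs_mul, mul_zero, add_zero]
        obtain ⟨i, rfl⟩ := Nat.exists_eq_add_of_le' h1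
        have := hstep i hi
        refine (mul_le_of_le_one_right (abs_nonneg _) (hu _)).trans ?_
        simpa using this
      · rw [sub_zero, abs_mul, mul_one]
        exact (mul_le_of_le_one_right (abs_nonneg _) (hu _)).trans
          ((hk i hi).trans (le_add_of_nonneg_left hA))
      · omega
    refine le_trans (le_of_eq ?_) ((abs_add_le _ _).trans
      ((add_le_add e1 e2).trans_eq (by ring)))
    congr 1
    rw [pow_succ]
    linear_combination (-(d i - c) ^ k) * huc i
  calc _ ≤ ∑ i : Fin n, (2 * A + R ^ k * (if (i : ℕ) + 1 = n then 1 else 0) +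
        R ^ k * (if (i : ℕ) = 0 then 1 else 0)) := sum_le_sum fun i _ => hpt i
    _ ≤ ∑ _i : Fin n, 2 * A + R ^ k * 1 + R ^ k * 1 := by
        rw [sum_add_distrib, sum_add_distrib, ← mul_sum _ _ (R ^ k), ← mul_sum _ _ (R ^ k)]
        gcongr ?_ + _ * ?_ + _ * ?_
        · exact le_rfl
        · exact sum_fin_ite_le_one _ fun a b ha hb => Fin.ext (by omega)
        · exact sum_fin_ite_le_one _ fun a b ha hb => Fin.ext (by omega)
    _ ≤ _ := by
        have h1 : 0 ≤ k * R ^ (k - 1) := by positivity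
        have h2 : 0 ≤ R ^ k * (n * δ) := by positivity
        rw [sum_const, card_univ, Fintype.card_fin, nsmul_eq_mul, hA_def]
        nlinarith

lemma exists_sum_abs_jacobiMatrix_pow_mulVec_wave_sub_le {M : ℝ} (hM : 0 ≤ M) (k : ℕ) :
    ∃ C : ℝ, 0 ≤ C ∧ ∀ (n : ℕ) (d u : ℤ → ℝ) (δ c : ℝ), 0 ≤ δ →
      (∀ i : ℕ, i < n → |d i| ≤ M) → (∀ i : ℕ, i + 1 < n → |d (i + 1) - d i| ≤ δ) → |c| ≤ 2 →
      (∀ i, |u i| ≤ 1) → (∀ i, u (i - 1) + u (i + 1) = c * u i) →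
      ∑ i : Fin n, |((jacobiMatrix d n ^ k) *ᵥ fun j => u (j : ℕ)) i -
        (d (i : ℕ) - c) ^ k * u (i : ℕ)| ≤ C * (n * δ + 1) := by
  induction k with
  | zero => exact ⟨0, le_rfl, fun n d u δ c _ _ _ _ _ _ => by simp⟩
  | succ k ih =>
    obtain ⟨C, hC, ih⟩ := ih
    refine ⟨(M + 2) * C + 2 * (k * (M + 2) ^ (k - 1) + (M + 2) ^ k), by positivity,
      fun n d u δ c hδ hd hdδ hc hu huc => ?_⟩
    have h1 := ih n d u δ c hδ hd hdδ hc hu huc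
    have h2 := sum_abs_jacobiMatrix_mulVec_wave_sub_le k hM hδ hd hdδ hc hu huc
    have h3 := sum_abs_jacobiMatrix_mulVec_le hd
      (((jacobiMatrix d n ^ k) *ᵥ fun j => u (j : ℕ)) -
        fun i : Fin n => (d (i : ℕ) - c) ^ k * u (i : ℕ))
    rw [mulVec_sub, mulVec_mulVec, ← pow_succ'] at h3
    simp only [Pi.sub_apply] at h3
    have h4 := h3.trans (mul_le_mul_of_nonneg_left h1 (by positivity))
    rw [add_mul, mul_assoc]
    refine le_trans ?_ (add_le_add h4 h2)
    rw [← sum_add_distrib]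
    exact sum_le_sum fun i _ => abs_sub_le _ _ _

lemma Matrix.IsHermitian.trace_pow_eq_sum_eigenvalues {ι : Type*} [Fintype ι] [DecidableEq ι]
    {A : Matrix ι ι ℝ} (hA : A.IsHermitian) (k : ℕ) :
    (A ^ k).trace = ∑ i, hA.eigenvalues i ^ k := by
  conv_lhs => rw [hA.spectral_theorem, ← map_pow, Unitary.conjStarAlgAut_apply, trace_mul_cycle,
    Unitary.coe_star_mul_self, one_mul, diagonal_pow]
  simp [trace_diagonal]

lemma abs_eigenvalues_jacobiMatrix_le {d : ℤ → ℝ} {n : ℕ} {M : ℝ}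
    (hd : ∀ i : ℕ, i < n → |d i| ≤ M) (hA : (jacobiMatrix d n).IsHermitian) (j : Fin n) :
    |hA.eigenvalues j| ≤ M + 2 := by
  have h := sum_abs_jacobiMatrix_mulVec_le hd (hA.eigenvectorBasis j)
  rw [hA.mulVec_eigenvectorBasis j] at h
  simp only [Pi.smul_apply, smul_eq_mul, abs_mul, ← mul_sum] at h
  refine le_of_mul_le_mul_right h ?_
  have h0 : hA.eigenvectorBasis j ≠ 0 := hA.eigenvectorBasis.orthonormal.ne_zero j
  by_contra! hle
  refine h0 (PiLp.ext fun i => ?_)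
  have := (sum_eq_zero_iff_of_nonneg fun i _ => abs_nonneg (hA.eigenvectorBasis j i)).1
    (hle.antisymm (sum_nonneg fun i _ => abs_nonneg _)) i (mem_univ i)
  simpa using this

lemma integral_cos_int_mul (m : ℤ) :
    ∫ t in (0 : ℝ)..(2 * Real.pi), Real.cos (m * t) = if m = 0 then 2 * Real.pi else 0 := by
  split_ifs with h
  · simp [h]
  · rw [intervalIntegral.integral_comp_mul_left Real.cos (by exact_mod_cast h), integral_cos]
    have := Real.sin_int_mul_pi (m * 2)
    push_cast at this
    simp [← mul_assoc, this]

lemma integral_trig_bilin_eq_trace {n : ℕ} (A : Matrix (Fin n) (Fin n) ℝ) :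
    ∫ t in (0 : ℝ)..(2 * Real.pi), ∑ i : Fin n,
      ((A *ᵥ fun j => Real.cos ((j : ℕ) * t)) i * Real.cos ((i : ℕ) * t) +
        (A *ᵥ fun j => Real.sin ((j : ℕ) * t)) i * Real.sin ((i : ℕ) * t)) =
      2 * Real.pi * A.trace := by
  have h (t : ℝ) (i : Fin n) :
      (A *ᵥ fun j => Real.cos ((j : ℕ) * t)) i * Real.cos ((i : ℕ) * t) +
        (A *ᵥ fun j => Real.sin ((j : ℕ) * t)) i * Real.sin ((i : ℕ) * t) =
      ∑ j : Fin n, A i j * Real.cos (((j : ℕ) - (i : ℕ) : ℤ) * t) := by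
    simp only [mulVec, dotProduct, sum_mul, ← sum_add_distrib]
    refine sum_congr rfl fun j _ => ?_
    push_cast
    rw [sub_mul, Real.cos_sub]
    ring
  simp only [h]
  rw [intervalIntegral.integral_finsetSum fun i _ =>
    (by fun_prop : Continuous _).intervalIntegrable _ _]
  rw [trace, mul_sum]
  refine sum_congr rfl fun i _ => ?_
  rw [intervalIntegral.integral_finsetSum fun i _ =>
    (by fun_prop : Continuous _).intervalIntegrable _ _]
  simp only [intervalIntegral.integral_const_mul, integral_cos_int_mul, sub_eq_zero, Nat.cast_inj,
    ← Fin.ext_iff]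
  simp [mul_comm]

lemma exists_abs_trace_jacobiMatrix_pow_sub_le {M : ℝ} (hM : 0 ≤ M) (k : ℕ) :
    ∃ C : ℝ, 0 ≤ C ∧ ∀ (n : ℕ) (d : ℤ → ℝ) (δ : ℝ), 0 ≤ δ →
      (∀ i : ℕ, i < n → |d i| ≤ M) → (∀ i : ℕ, i + 1 < n → |d (i + 1) - d i| ≤ δ) →
      |2 * Real.pi * (jacobiMatrix d n ^ k).trace -
        ∑ i : Fin n, ∫ t in (0 : ℝ)..(2 * Real.pi), (d (i : ℕ) - 2 * Real.cos t) ^ k| ≤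
        C * (n * δ + 1) := by
  obtain ⟨C, hC, h⟩ := exists_sum_abs_jacobiMatrix_pow_mulVec_wave_sub_le hM k
  refine ⟨2 * C * (2 * Real.pi), by positivity, fun n d δ hδ hd hdδ => ?_⟩
  set B := jacobiMatrix d n ^ k
  have hcont : Continuous fun t : ℝ => ∑ i : Fin n,
      ((B *ᵥ fun j => Real.cos ((j : ℕ) * t)) i * Real.cos ((i : ℕ) * t) +
        (B *ᵥ fun j => Real.sin ((j : ℕ) * t)) i * Real.sin ((i : ℕ) * t)) := by
    simp only [mulVec, dotProduct]
    fun_prop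
  rw [← integral_trig_bilin_eq_trace, ← intervalIntegral.integral_finsetSum fun i _ =>
    (by fun_prop : Continuous _).intervalIntegrable _ _,
    ← intervalIntegral.integral_sub (hcont.intervalIntegrable _ _)
      ((by fun_prop : Continuous _).intervalIntegrable _ _)]
  have hpt (t : ℝ) : ‖(∑ i : Fin n,
      ((B *ᵥ fun j => Real.cos ((j : ℕ) * t)) i * Real.cos ((i : ℕ) * t) +
        (B *ᵥ fun j => Real.sin ((j : ℕ) * t)) i * Real.sin ((i : ℕ) * t))) -
      ∑ i : Fin n, (d (i : ℕ) - 2 * Real.cos t) ^ k‖ ≤ 2 * C * (n * δ + 1) := by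
    have hc2 : |2 * Real.cos t| ≤ 2 := by
      rw [abs_mul, abs_two]; linarith [Real.abs_cos_le_one t]
    have h1 := h n d (fun i => Real.cos (i * t)) δ (2 * Real.cos t) hδ hd hdδ hc2
      (fun i => Real.abs_cos_le_one _) (fun i => by
        push_cast
        rw [sub_mul, add_mul, one_mul, Real.cos_sub, Real.cos_add]; ring)
    have h2 := h n d (fun i => Real.sin (i * t)) δ (2 * Real.cos t) hδ hd hdδ hc2
      (fun i => Real.abs_sin_le_one _) (fun i => by
        push_cast
        rw [sub_mul, add_mul, one_mul, Real.sin_sub, Real.sin_add]; ring)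
    refine le_trans ?_ ((add_le_add h1 h2).trans_eq (by ring))
    rw [← sum_add_distrib, ← sum_sub_distrib, Real.norm_eq_abs]
    refine (abs_sum_le_sum_abs _ _).trans (sum_le_sum fun i _ => ?_)
    simp only [Int.cast_natCast]
    set x := (B *ᵥ fun j : Fin n => Real.cos ((j : ℕ) * t)) i
    set y := (B *ᵥ fun j : Fin n => Real.sin ((j : ℕ) * t)) i
    set a := (d (i : ℕ) - 2 * Real.cos t) ^ k
    set p := Real.cos ((i : ℕ) * t)
    set q := Real.sin ((i : ℕ) * t)
    have hpq : p ^ 2 + q ^ 2 = 1 := Real.cos_sq_add_sin_sq _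
    rw [show x * p + y * q - a = (x - a * p) * p + (y - a * q) * q by
      linear_combination a * hpq]
    refine (abs_add_le _ _).trans (add_le_add ?_ ?_) <;> rw [abs_mul] <;>
      refine mul_le_of_le_one_right (abs_nonneg _) ?_
    exacts [Real.abs_cos_le_one _, Real.abs_sin_le_one _]
  refine (intervalIntegral.norm_integral_le_of_norm_le_const fun t _ => hpt t).trans_eq ?_
  rw [sub_zero, abs_of_pos Real.two_pi_pos]
  ring

/-- Szegő-type limit for Jacobi matrices with slowly varying diagonal, for polynomial test
functions. -/
lemma tendsto_jacobiMatrix_polynomial {d : ℕ → ℤ → ℝ} {M : ℝ} (hM : 0 ≤ M)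
    (hd : ∀ n, ∀ i : ℕ, i < n → |d n i| ≤ M)
    (hdδ : ∀ δ > 0, ∀ᶠ n in atTop, ∀ i : ℕ, i + 1 < n → |d n (i + 1) - d n i| ≤ δ)
    (hA : ∀ n, (jacobiMatrix (d n) n).IsHermitian) (p : Polynomial ℝ) :
    Tendsto (fun n : ℕ => (2 * Real.pi * ∑ j, p.eval ((hA n).eigenvalues j) -
      ∑ i : Fin n, ∫ t in (0 : ℝ)..(2 * Real.pi), p.eval (d n (i : ℕ) - 2 * Real.cos t)) / n)
      atTop (𝓝 0) := by
  induction p using Polynomial.induction_on' with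
  | add p q hp hq =>
    have hpq := hp.add hq
    rw [add_zero] at hpq
    refine hpq.congr fun n => ?_
    have (i : Fin n) : ∫ t in (0 : ℝ)..(2 * Real.pi), (p + q).eval (d n (i : ℕ) - 2 * Real.cos t) =
        (∫ t in (0 : ℝ)..(2 * Real.pi), p.eval (d n (i : ℕ) - 2 * Real.cos t)) +
        ∫ t in (0 : ℝ)..(2 * Real.pi), q.eval (d n (i : ℕ) - 2 * Real.cos t) := by
      simp only [Polynomial.eval_add]
      exact intervalIntegral.integral_add ((by fun_prop : Continuous _).intervalIntegrable _ _)
        ((by fun_prop : Continuous _).intervalIntegrable _ _)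
    simp only [this]
    simp only [Polynomial.eval_add, sum_add_distrib]
    ring
  | monomial k a =>
    have key : Tendsto (fun n : ℕ => (2 * Real.pi * (jacobiMatrix (d n) n ^ k).trace -
        ∑ i : Fin n, ∫ t in (0 : ℝ)..(2 * Real.pi), (d n (i : ℕ) - 2 * Real.cos t) ^ k) / n)
        atTop (𝓝 0) := by
      obtain ⟨C, hC, h⟩ := exists_abs_trace_jacobiMatrix_pow_sub_le hM k
      rw [Metric.tendsto_nhds]
      intro η hη
      have hlim : Tendsto (fun n : ℕ => C * (η / (2 * (C + 1)) + 1 / (n : ℝ))) atTop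
          (𝓝 (C * (η / (2 * (C + 1)) + 0))) :=
        (tendsto_one_div_atTop_nhds_zero_nat.const_add _).const_mul _
      have hlt : C * (η / (2 * (C + 1)) + 0) < η := by
        rw [add_zero, ← mul_div_assoc, div_lt_iff₀ (by positivity)]
        nlinarith
      filter_upwards [hdδ (η / (2 * (C + 1))) (by positivity), hlim.eventually_lt_const hlt,
        eventually_gt_atTop 0] with n hn1 hn2 hn3
      have hn : (0 : ℝ) < n := by exact_mod_cast hn3
      rw [Real.dist_eq, sub_zero, abs_div, abs_of_pos hn]
      refine lt_of_le_of_lt ?_ hn2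
      rw [div_le_iff₀ hn]
      refine (h n (d n) _ (by positivity) (hd n) hn1).trans_eq ?_
      field_simp
    have := key.const_mul a
    rw [mul_zero] at this
    refine this.congr fun n => ?_
    simp only [Polynomial.eval_monomial, intervalIntegral.integral_const_mul, ← mul_sum,
      (hA n).trace_pow_eq_sum_eigenvalues k]
    ring

/-- Szegő-type limit for Jacobi matrices with slowly varying diagonal. -/
lemma tendsto_jacobiMatrix_continuous {d : ℕ → ℤ → ℝ} {M : ℝ} (hM : 0 ≤ M)
    (hd : ∀ n, ∀ i : ℕ, i < n → |d n i| ≤ M)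
    (hdδ : ∀ δ > 0, ∀ᶠ n in atTop, ∀ i : ℕ, i + 1 < n → |d n (i + 1) - d n i| ≤ δ)
    (hA : ∀ n, (jacobiMatrix (d n) n).IsHermitian) {φ : ℝ → ℝ} (hφ : Continuous φ) :
    Tendsto (fun n : ℕ => (2 * Real.pi * ∑ j, φ ((hA n).eigenvalues j) -
      ∑ i : Fin n, ∫ t in (0 : ℝ)..(2 * Real.pi), φ (d n (i : ℕ) - 2 * Real.cos t)) / n)
      atTop (𝓝 0) := by
  rw [Metric.tendsto_nhds]
  intro η hη
  have hpi := Real.two_pi_pos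
  set γ := η / (8 * Real.pi + 1) with hγ_def
  have hγ : 0 < γ := by positivity
  have hγη : 4 * Real.pi * γ < η / 2 := by
    rw [hγ_def, ← mul_div_assoc, div_lt_iff₀ (by positivity)]
    nlinarith
  obtain ⟨p, hp⟩ := exists_polynomial_near_of_continuousOn (-(M + 2)) (M + 2) φ hφ.continuousOn γ hγ
  have hp' (x : ℝ) (hx : |x| ≤ M + 2) : |φ x - p.eval x| ≤ γ := by
    rw [abs_sub_comm]
    exact (hp x (abs_le.1 hx)).le
  have hlim := Metric.tendsto_nhds.1 (tendsto_jacobiMatrix_polynomial hM hd hdδ hA p) (η / 2)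
    (half_pos hη)
  filter_upwards [hlim, eventually_gt_atTop 0] with n hn1 hn2
  have hn : (0 : ℝ) < n := by exact_mod_cast hn2
  rw [Real.dist_eq, sub_zero] at hn1 ⊢
  have e1 : |∑ j, φ ((hA n).eigenvalues j) - ∑ j, p.eval ((hA n).eigenvalues j)| ≤ n * γ := by
    rw [← sum_sub_distrib]
    refine (abs_sum_le_sum_abs _ _).trans ((sum_le_sum fun j _ =>
      hp' _ (abs_eigenvalues_jacobiMatrix_le (hd n) (hA n) j)).trans_eq (by simp))
  have e2 : |∑ i : Fin n, (∫ t in (0 : ℝ)..(2 * Real.pi), φ (d n (i : ℕ) - 2 * Real.cos t)) -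
      ∑ i : Fin n, ∫ t in (0 : ℝ)..(2 * Real.pi), p.eval (d n (i : ℕ) - 2 * Real.cos t)| ≤
      n * (γ * (2 * Real.pi)) := by
    rw [← sum_sub_distrib]
    refine (abs_sum_le_sum_abs _ _).trans ((sum_le_sum (g := fun _ => γ * (2 * Real.pi))
      fun i _ => ?_).trans_eq (by simp))
    rw [← intervalIntegral.integral_sub ((by fun_prop : Continuous _).intervalIntegrable _ _)
      ((by fun_prop : Continuous _).intervalIntegrable _ _)]
    have hbound (t : ℝ) : ‖φ (d n (i : ℕ) - 2 * Real.cos t) -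
        p.eval (d n (i : ℕ) - 2 * Real.cos t)‖ ≤ γ := by
      refine hp' _ ?_
      refine (abs_sub _ _).trans (add_le_add (hd n i i.2) ?_)
      rw [abs_mul, abs_two]
      linarith [Real.abs_cos_le_one t]
    exact (intervalIntegral.norm_integral_le_of_norm_le_const fun t _ => hbound t).trans_eq
        (by rw [sub_zero, abs_of_pos hpi])
  rw [abs_div, abs_of_pos hn, div_lt_iff₀ hn] at hn1 ⊢
  rw [abs_le] at e1 e2
  rw [abs_lt] at hn1 ⊢
  have e3 := mul_le_mul_of_nonneg_left e1.1 hpi.le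
  have e4 := mul_le_mul_of_nonneg_left e1.2 hpi.le
  have e5 := mul_lt_mul_of_pos_left hγη hn
  constructor <;> nlinarith

lemma tendsto_riemann_sum_shift {g : ℝ → ℝ} (hg : Continuous g) (ε : ℝ) :
    Tendsto (fun n : ℕ => (∑ i : Fin n, g (((i : ℕ) + ε) / n)) / n) atTop
      (𝓝 (∫ x in (0 : ℝ)..1, g x)) := by
  rw [Metric.tendsto_nhds]
  intro η hη
  have huc := (isCompact_Icc (a := -(1 + |ε|)) (b := 1 + |ε|)).uniformContinuousOn_of_continuous
    hg.continuousOn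
  obtain ⟨δ, hδ, huc⟩ := Metric.uniformContinuousOn_iff.1 huc (η / 2) (half_pos hη)
  filter_upwards [(tendsto_const_div_atTop_nhds_zero_nat (1 + |ε|)).eventually_lt_const hδ,
    eventually_gt_atTop 0] with n hn1 hn2
  have hn : (0 : ℝ) < n := by exact_mod_cast hn2
  have h1n : (1 : ℝ) ≤ n := by exact_mod_cast hn2
  have hsplit : ∫ x in (0 : ℝ)..1, g x =
      ∑ i : Fin n, ∫ x in ((i : ℕ) / n : ℝ)..(((i : ℕ) + 1) / n : ℝ), g x := by
    rw [Fin.sum_univ_eq_sum_range (fun i : ℕ => ∫ x in (i / n : ℝ)..((i + 1) / n : ℝ), g x) n]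
    have := intervalIntegral.sum_integral_adjacent_intervals (μ := MeasureTheory.volume)
      (f := g) (a := fun i : ℕ => (i / n : ℝ)) (n := n)
      fun k _ => hg.intervalIntegrable _ _
    push_cast at this
    rw [this, zero_div, div_self hn.ne']
  rw [Real.dist_eq, hsplit, sum_div, ← sum_sub_distrib]
  refine lt_of_le_of_lt ((abs_sum_le_sum_abs _ _).trans
    (sum_le_sum (g := fun _ => η / 2 * (1 / n)) fun i _ => ?_)) ?_
  · have hi : ((i : ℕ) : ℝ) + 1 ≤ n := by exact_mod_cast i.2
    have hi0 : (0 : ℝ) ≤ (i : ℕ) := Nat.cast_nonneg _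
    have hlen : (((i : ℕ) + 1) / n : ℝ) - (i : ℕ) / n = 1 / n := by ring
    have hconst : g (((i : ℕ) + ε) / n) / n =
        ∫ _x in ((i : ℕ) / n : ℝ)..(((i : ℕ) + 1) / n : ℝ), g (((i : ℕ) + ε) / n) := by
      rw [intervalIntegral.integral_const, hlen, smul_eq_mul]
      ring
    rw [hconst, ← intervalIntegral.integral_sub (by simp) (hg.intervalIntegrable _ _)]
    have hbound : ∀ x ∈ Set.uIoc ((i : ℕ) / n : ℝ) (((i : ℕ) + 1) / n),
        ‖g (((i : ℕ) + ε) / n) - g x‖ ≤ η / 2 := by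
      intro x hx
      rw [Set.uIoc_of_le (by gcongr; linarith), Set.mem_Ioc, div_lt_iff₀ hn, le_div_iff₀ hn] at hx
      obtain ⟨hx1, hx2⟩ := hx
      have hε := abs_le.1 (le_refl |ε|)
      refine (huc (((i : ℕ) + ε) / n) ?_ x ?_ ?_).le
      · rw [Set.mem_Icc, le_div_iff₀ hn, div_le_iff₀ hn]
        constructor <;> nlinarith [abs_nonneg ε]
      · rw [Set.mem_Icc]
        constructor <;> nlinarith [abs_nonneg ε]
      · refine lt_of_le_of_lt ?_ hn1
        rw [Real.dist_eq, show ((i : ℕ) + ε) / n - x = ((i : ℕ) + ε - x * n) / n by field_simp,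
          abs_div, abs_of_pos hn]
        gcongr
        rw [abs_le]
        constructor <;> linarith
    exact (intervalIntegral.norm_integral_le_of_norm_le_const hbound).trans_eq
      (by rw [hlen, abs_of_pos (by positivity)])
  · rw [sum_const, card_univ, Fintype.card_fin, nsmul_eq_mul]
    field_simp
    linarith

lemma TmatShift_eq_jacobiMatrix (f : ℝ → ℝ) (ε : ℝ) (n : ℕ) :
    TmatShift f ε n = jacobiMatrix (fun i => f ((i + ε) / n)) n := by
  ext i j
  simp only [TmatShift, jacobiMatrix, Matrix.of_apply, Int.cast_natCast]
  split_ifs <;> first | omega | simp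

/-- Kac–Murdock–Szegő-type eigenvalue distribution result: for the eigenvalues
λ_1^{(n)},…,λ_n^{(n)} of the real symmetric matrix T_n(f;ε),
lim_{n→∞} (1/n)∑_j φ(λ_j^{(n)}) = (1/2π)∫₀¹∫₀^{2π} φ(f(x) − 2cos t) dt dx,
independently of ε. -/
theorem kms_eigenvalue_distribution (f φ : ℝ → ℝ)
    (hf : Continuous f) (hφ : Continuous φ) (ε : ℝ)
    (hsym : ∀ n : ℕ, (TmatShift f ε n).IsHermitian) :
    Tendsto (fun n : ℕ => (1 / (n : ℝ)) * ∑ j : Fin n, φ ((hsym n).eigenvalues j))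
      atTop
      (𝓝 ((1 / (2 * Real.pi)) *
        ∫ x in (0:ℝ)..1, ∫ t in (0:ℝ)..(2 * Real.pi), φ (f x - 2 * Real.cos t))) := by
  have hpi := Real.two_pi_pos
  have hK := isCompact_Icc (a := -(1 + |ε|)) (b := 1 + |ε|)
  obtain ⟨M, hM⟩ := hK.exists_bound_of_continuousOn hf.continuousOn
  have hM0 : 0 ≤ M := (norm_nonneg _).trans (hM 0 (by constructor <;> linarith [abs_nonneg ε]))
  have hmem (n i : ℕ) (hi : i < n) : ((i : ℝ) + ε) / n ∈ Set.Icc (-(1 + |ε|)) (1 + |ε|) := by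
    have hi' : (i : ℝ) + 1 ≤ n := by exact_mod_cast hi
    have hi0 : (0 : ℝ) ≤ i := Nat.cast_nonneg _
    have hε := abs_le.1 (le_refl |ε|)
    rw [Set.mem_Icc, le_div_iff₀ (by linarith), div_le_iff₀ (by linarith)]
    constructor <;> nlinarith [abs_nonneg ε]
  have hA (n : ℕ) : (jacobiMatrix (fun i => f ((i + ε) / n)) n).IsHermitian :=
    TmatShift_eq_jacobiMatrix f ε n ▸ hsym n
  have heig (n : ℕ) : (hsym n).eigenvalues = (hA n).eigenvalues := by
    congr 1
    exact TmatShift_eq_jacobiMatrix f ε n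
  have hJ := tendsto_jacobiMatrix_continuous (d := fun n i => f ((i + ε) / n)) hM0
    (fun n i hi => by simpa using hM _ (hmem n i hi))
    (fun η hη => by
      obtain ⟨δ, hδ, huc⟩ := Metric.uniformContinuousOn_iff.1
        (hK.uniformContinuousOn_of_continuous hf.continuousOn) η hη
      filter_upwards [tendsto_one_div_atTop_nhds_zero_nat.eventually_lt_const hδ] with n hn i hi
      have h2 := hmem n (i + 1) hi
      push_cast at h2 ⊢
      refine (huc _ h2 _ (hmem n i (by omega)) ?_).le
      rw [Real.dist_eq, show ((i : ℝ) + 1 + ε) / n - (i + ε) / n = 1 / n by ring,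
        abs_of_nonneg (by positivity)]
      exact hn) hA hφ
  have hR := tendsto_riemann_sum_shift
    (g := fun x => ∫ t in (0:ℝ)..(2 * Real.pi), φ (f x - 2 * Real.cos t))
    (intervalIntegral.continuous_parametric_intervalIntegral_of_continuous' (by fun_prop) _ _) ε
  have := (hJ.add hR).const_mul (1 / (2 * Real.pi))
  rw [zero_add] at this
  refine this.congr fun n => ?_
  rw [heig]
  simp only [Int.cast_natCast]
  rw [← add_div, sub_add_cancel]
  field_simp
end
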